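/- Let L be a C^k (k ≥ 2) Tonelli Lagrangian on T𝕋ⁿ. For every T > 0 and M > 0 there exists a constant R > 0 such that every extremal curve δ : [0,T] → ℝⁿ with action A_L(δ) < M satisfies ‖δ'(s)‖ ≤ R for all s ∈ [0,T]; moreover, the same constant R works for any other Tonelli Lagrangian that coincides with L on ℝⁿ × B(0,R). -/

import Mathlib

open MeasureTheory
open scoped NNReal

noncomputable section

abbrev E (n : ℕ) : Type := Fin n → ℝ

/-- The vector of `ℝⁿ` whose coordinates are the integers `m i`. -/
def intVec {n : ℕ} (m : Fin n → ℤ) : E n := fun i => (m i : ℝ)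

/-- A Tonelli Lagrangian on `T𝕋ⁿ`, identified with a `ℤⁿ`-periodic (in `x`) function
on `ℝⁿ × ℝⁿ` which is `Cᵏ`, uniformly superlinear in `v` and with positive definite
fiberwise Hessian. -/
structure IsTonelliLagrangian (n : ℕ) (k : ℕ∞) (L : E n × E n → ℝ) : Prop where
  smooth : ContDiff ℝ k L
  periodic : ∀ (x v : E n) (m : Fin n → ℤ), L (x + intVec m, v) = L (x, v)
  superlinear : ∀ C : ℝ, ∃ R : ℝ, ∀ (x v : E n), R ≤ ‖v‖ → C * ‖v‖ ≤ L (x, v)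
  posdef : ∀ (x v w : E n), w ≠ 0 →
    0 < fderiv ℝ (fun v' => fderiv ℝ (fun v'' => L (x, v'')) v' w) v w

/-- Partial differential of `L` in the fiber (velocity) direction. -/
def partialV (n : ℕ) (L : E n × E n → ℝ) (x v : E n) : E n →L[ℝ] ℝ :=
  fderiv ℝ (fun v' => L (x, v')) v

/-- Partial differential of `L` in the base (position) direction. -/
def partialX (n : ℕ) (L : E n × E n → ℝ) (x v : E n) : E n →L[ℝ] ℝ :=
  fderiv ℝ (fun x' => L (x', v)) x

/-- A `C²` curve satisfying the Euler–Lagrange equation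
`d/dt (∂L/∂v(γ, γ')) = ∂L/∂x(γ, γ')`. -/
def IsExtremal (n : ℕ) (L : E n × E n → ℝ) (γ : ℝ → E n) : Prop :=
  ContDiff ℝ 2 γ ∧
  ∀ t : ℝ, HasDerivAt (fun s => partialV n L (γ s) (deriv γ s))
    (partialX n L (γ t) (deriv γ t)) t

/-- `φ` is the (complete, `C^{k-1}`) Euler–Lagrange flow of `L` on `ℝⁿ × ℝⁿ`:
`φ t (x,v) = (γ t, γ' t)` where `γ` is the extremal curve with `(γ 0, γ' 0) = (x, v)`. -/
def IsELFlow (n : ℕ) (k : ℕ) (L : E n × E n → ℝ)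
    (φ : ℝ → E n × E n → E n × E n) : Prop :=
  ContDiff ℝ ((k - 1 : ℕ) : ℕ∞) (fun p : ℝ × (E n × E n) => φ p.1 p.2) ∧
  (∀ z : E n × E n, φ 0 z = z) ∧
  ∀ x v : E n, IsExtremal n L (fun t => (φ t (x, v)).1) ∧
    ∀ t : ℝ, (φ t (x, v)).2 = deriv (fun s => (φ s (x, v)).1) t

/-- The flow `φ` has no conjugate points: for `t ≠ 0` the image of the vertical
subspace `{0} × ℝⁿ` under `Dφ_t(z)` meets `{0} × ℝⁿ` only in `0`. -/
def NoConjugatePoints (n : ℕ) (φ : ℝ → E n × E n → E n × E n) : Prop :=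
  ∀ (z : E n × E n) (t : ℝ), t ≠ 0 → ∀ w : E n,
    (fderiv ℝ (φ t) z (0, w)).1 = 0 → w = 0

/-- The absolutely continuous curve starting at `x` with derivative `g`. -/
def curveOf (n : ℕ) (x : E n) (g : ℝ → E n) : ℝ → E n :=
  fun s => x + ∫ u in (0:ℝ)..s, g u

/-- `Acost n L t x y` = the infimum of the Lagrangian action over all absolutely
continuous curves `c : [0,t] → ℝⁿ` with `c 0 = x` and `c t = y`. -/
def Acost (n : ℕ) (L : E n × E n → ℝ) (t : ℝ) (x y : E n) : ℝ :=
  sInf { A : ℝ | ∃ g : ℝ → E n,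
    IntervalIntegrable g volume 0 t ∧
    curveOf n x g t = y ∧
    IntervalIntegrable (fun s => L (curveOf n x g s, g s)) volume 0 t ∧
    A = ∫ s in (0:ℝ)..t, L (curveOf n x g s, g s) }

/-- The energy `∂L/∂v(x, v) v - L(x, v)` of a Lagrangian. -/
def energy (n : ℕ) (L : E n × E n → ℝ) (x v : E n) : ℝ :=
  partialV n L x v v - L (x, v)

lemma partialV_apply {n : ℕ} {L : E n × E n → ℝ} {x v : E n}
    (hL : DifferentiableAt ℝ L (x, v)) (w : E n) :
    partialV n L x v w = fderiv ℝ L (x, v) (0, w) := by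
  have h : HasFDerivAt (fun v' => L (x, v'))
      ((fderiv ℝ L (x, v)).comp (ContinuousLinearMap.inr ℝ (E n) (E n))) v :=
    HasFDerivAt.comp v hL.hasFDerivAt (hasFDerivAt_prodMk_right x v)
  simp [partialV, h.fderiv]

lemma partialX_apply {n : ℕ} {L : E n × E n → ℝ} {x v : E n}
    (hL : DifferentiableAt ℝ L (x, v)) (w : E n) :
    partialX n L x v w = fderiv ℝ L (x, v) (w, 0) := by
  have h : HasFDerivAt (fun x' => L (x', v))
      ((fderiv ℝ L (x, v)).comp (ContinuousLinearMap.inl ℝ (E n) (E n))) x :=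
    HasFDerivAt.comp (g := L) x hL.hasFDerivAt (hasFDerivAt_prodMk_left x v)
  simp [partialX, h.fderiv]

lemma energy_congr {n : ℕ} {L L' : E n × E n → ℝ} {x x' v : E n}
    (h : (fun w => L (x, w)) =ᶠ[nhds v] fun w => L' (x', w)) :
    energy n L x v = energy n L' x' v := by
  have h' : L (x, v) = L' (x', v) := h.eq_of_nhds
  simp only [energy, partialV, h.fderiv_eq, h']

lemma continuous_energy {n : ℕ} {L : E n × E n → ℝ} (hL : ContDiff ℝ 1 L) :
    Continuous fun z : E n × E n => energy n L z.1 z.2 := by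
  have h : (fun z : E n × E n => energy n L z.1 z.2)
      = fun z => fderiv ℝ L z (0, z.2) - L z := by
    funext z
    simp [energy, partialV_apply (hL.differentiable (by norm_num) _)]
  rw [h]
  exact ((hL.continuous_fderiv (by norm_num)).clm_apply (by fun_prop)).sub hL.continuous

/-- Conservation of energy along extremal curves. -/
lemma IsExtremal.energy_eq {n : ℕ} {L : E n × E n → ℝ} {γ : ℝ → E n}
    (hL : Differentiable ℝ L) (hγ : IsExtremal n L γ) (s t : ℝ) :
    energy n L (γ s) (deriv γ s) = energy n L (γ t) (deriv γ t) := by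
  have hd : Differentiable ℝ (deriv γ) :=
    ((contDiff_succ_iff_deriv (n := 1)).1 hγ.1).2.2.differentiable (by norm_num)
  have key : ∀ r, HasDerivAt (fun r => energy n L (γ r) (deriv γ r)) 0 r := by
    intro r
    have h1 := (hγ.2 r).clm_apply (hd r).hasDerivAt
    have h0 := (hγ.1.differentiable (by norm_num) r).hasDerivAt
    have h2 : HasDerivAt (fun r => L (γ r, deriv γ r))
        (fderiv ℝ L (γ r, deriv γ r) (deriv γ r, deriv (deriv γ) r)) r :=
      (hL (γ r, deriv γ r)).hasFDerivAt.comp_hasDerivAt r (h0.prodMk (hd r).hasDerivAt)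
    refine (h1.sub h2).congr_deriv ?_
    rw [partialX_apply (hL _), partialV_apply (hL _), ← map_add, ← map_sub]
    simp
  exact is_const_of_deriv_eq_zero (fun r => (key r).differentiableAt)
    (fun r => (key r).deriv) s t

/-- Every position is congruent modulo `ℤⁿ` to a point of the unit cube. -/
lemma exists_add_intVec_mem_Icc {n : ℕ} (x : E n) :
    ∃ m : Fin n → ℤ, ∃ y ∈ Set.Icc (0 : E n) 1, x = y + intVec m := by
  refine ⟨fun i => ⌊x i⌋, fun i => Int.fract (x i), ⟨fun i => Int.fract_nonneg _,
    fun i => (Int.fract_lt_one _).le⟩, ?_⟩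
  funext i
  simp [intVec]

/-- A continuous function which is periodic in the position is bounded on
bounded sets of velocities. -/
lemma exists_abs_le_of_periodic {n : ℕ} {f : E n → E n → ℝ}
    (hf : Continuous fun z : E n × E n => f z.1 z.2)
    (hp : ∀ (x v : E n) (m : Fin n → ℤ), f (x + intVec m) v = f x v) (r : ℝ) :
    ∃ A : ℝ, ∀ x v : E n, ‖v‖ ≤ r → |f x v| ≤ A := by
  obtain ⟨A, hA⟩ := ((isCompact_Icc (a := (0 : E n)) (b := 1)).prod
    (isCompact_closedBall (0 : E n) r)).exists_bound_of_continuousOn hf.continuousOn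
  refine ⟨A, fun x v hv => ?_⟩
  obtain ⟨m, y, hy, rfl⟩ := exists_add_intVec_mem_Icc x
  rw [hp]
  exact hA (y, v) ⟨hy, by simpa using hv⟩

namespace IsTonelliLagrangian

variable {n : ℕ} {k : ℕ∞} {L : E n × E n → ℝ}

lemma hasDerivAt_ray (hL : Differentiable ℝ L) (x u : E n) (t : ℝ) :
    HasDerivAt (fun t : ℝ => L (x, t • u)) (partialV n L x (t • u) u) t := by
  have h : HasDerivAt (fun t : ℝ => (x, t • u)) (0, u) t :=
    (hasDerivAt_const t x).prodMk (by simpa using (hasDerivAt_id t).smul_const u)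
  rw [partialV_apply (hL _)]
  exact (hL _).hasFDerivAt.comp_hasDerivAt t h

lemma differentiable (hL : IsTonelliLagrangian n k L) (hk : 2 ≤ k) : Differentiable ℝ L :=
  (hL.smooth.of_le (m := 2) (WithTop.coe_le_coe.2 hk)).differentiable (by norm_num)

lemma convexOn_ray (hL : IsTonelliLagrangian n k L) (hk : 2 ≤ k) (x : E n) {u : E n}
    (hu : u ≠ 0) : ConvexOn ℝ Set.univ fun t : ℝ => L (x, t • u) := by
  have hd := fun t => hasDerivAt_ray (hL.differentiable hk) x u t
  have h2 : ContDiff ℝ 2 fun v => L (x, v) :=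
    (hL.smooth.of_le (WithTop.coe_le_coe.2 hk)).comp (contDiff_prodMk_right x)
  have h1 : Differentiable ℝ fun v => fderiv ℝ (fun v' => L (x, v')) v u :=
    ((h2.fderiv_right (m := 1) (by norm_num)).clm_apply contDiff_const).differentiable
      (by norm_num)
  have h' : ∀ t : ℝ, HasDerivAt (fun t : ℝ => partialV n L x (t • u) u)
      (fderiv ℝ (fun v => fderiv ℝ (fun v' => L (x, v')) v u) (t • u) u) t := fun t =>
    ((h1 (t • u)).hasFDerivAt.comp_hasDerivAt (f := fun t : ℝ => t • u) t
      (by simpa using (hasDerivAt_id t).smul_const u) :)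
  have hmono : StrictMono fun t : ℝ => partialV n L x (t • u) u :=
    strictMono_of_deriv_pos fun t => by
      rw [(h' t).deriv]; exact hL.posdef x (t • u) u hu
  refine Monotone.convexOn_univ_of_deriv (fun t => (hd t).differentiableAt) ?_
  rw [show deriv (fun t : ℝ => L (x, t • u)) = fun t : ℝ => partialV n L x (t • u) u from
    funext fun t => (hd t).deriv]
  exact hmono.monotone

/-- A linear lower bound at one radius `r ≥ 1` propagates to larger velocities, both for the
Lagrangian and for its energy. -/
lemma lower_bounds (hL : IsTonelliLagrangian n k L) (hk : 2 ≤ k) {A C r : ℝ} (hr : 1 ≤ r)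
    (hA : ∀ x v : E n, ‖v‖ ≤ 1 → |L (x, v)| ≤ A)
    (hC : ∀ x v : E n, ‖v‖ = r → C * r ≤ L (x, v)) (x : E n) {v : E n} (hv : r ≤ ‖v‖) :
    (C - A) * ‖v‖ ≤ L (x, v) ∧ C - 2 * A ≤ energy n L x v := by
  have hpos : 0 < ‖v‖ := by linarith
  obtain ⟨t, u, hu, ht, rfl⟩ : ∃ (t : ℝ) (u : E n), ‖u‖ = 1 ∧ r ≤ t ∧ v = t • u := by
    refine ⟨‖v‖, ‖v‖⁻¹ • v, ?_, hv, ?_⟩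
    · rw [norm_smul, norm_inv, norm_norm, inv_mul_cancel₀ hpos.ne']
    · rw [smul_inv_smul₀ hpos.ne']
  have hu0 : u ≠ 0 := by rintro rfl; simp at hu
  have ht0 : 0 < t := by linarith
  have hnt : ‖t • u‖ = t := by rw [norm_smul, hu, mul_one, Real.norm_of_nonneg ht0.le]
  have hf := hL.convexOn_ray hk x hu0
  have hd := hasDerivAt_ray (hL.differentiable hk) x u t
  set f : ℝ → ℝ := fun s => L (x, s • u) with hfdef
  set p := partialV n L x (t • u) u with hp
  have hA0 := abs_le.1 (hA x (0 : E n) (by simp))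
  have hA1 := abs_le.1 (hA x u hu.le)
  have hf0 : f 0 = L (x, 0) := by simp [hfdef]
  have hf1 : f 1 = L (x, u) := by simp [hfdef]
  have hfr : C * r ≤ f r := hC x _ (by
    rw [norm_smul, hu, mul_one, Real.norm_of_nonneg (by linarith)])
  have tangent : ∀ s, f t + p * (s - t) ≤ f s := by
    intro s
    rcases lt_trichotomy s t with h | rfl | h
    · have := hf.slope_le_of_hasDerivAt (Set.mem_univ s) (Set.mem_univ t) h hd
      rw [slope_def_field, div_le_iff₀ (by linarith)] at this
      linarith
    · simp
    · have := hf.le_slope_of_hasDerivAt (Set.mem_univ t) (Set.mem_univ s) h hd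
      rw [slope_def_field, le_div_iff₀ (by linarith)] at this
      linarith
  have chord : t * (f r - f 0) ≤ r * (f t - f 0) := by
    have h := hf.2 (Set.mem_univ 0) (Set.mem_univ t) (show 0 ≤ 1 - r / t by
        rw [sub_nonneg, div_le_one ht0]; exact ht) (show 0 ≤ r / t by positivity) (by ring)
    have hrt : (1 - r / t) • (0 : ℝ) + (r / t) • t = r := by simp; field_simp
    rw [hrt] at h
    simp only [smul_eq_mul] at h
    have h2 := mul_le_mul_of_nonneg_left h ht0.le
    have h3 : t * ((1 - r / t) * f 0 + r / t * f t) = (t - r) * f 0 + r * f t := by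
      field_simp
    linarith
  have hr0 : 0 < r := by linarith
  have hA_nonneg : 0 ≤ A := by linarith
  have hCt := mul_le_mul_of_nonneg_left hfr ht0.le
  have hAt : t * A ≤ r * (t * A) := le_mul_of_one_le_left (by positivity) hr
  have slope : (C - A) * t ≤ f t - f 0 := by
    refine le_of_mul_le_mul_left ?_ hr0
    nlinarith [mul_le_mul_of_nonneg_left hA0.2 ht0.le]
  have hp_ge : C - A ≤ p := by
    refine le_of_mul_le_mul_right ?_ ht0
    linarith [tangent 0]
  rw [hnt]
  constructor
  · refine le_of_mul_le_mul_left ?_ hr0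
    change r * ((C - A) * t) ≤ r * f t
    nlinarith [mul_le_mul_of_nonneg_left hA0.2 (sub_nonneg.2 ht), mul_nonneg hr0.le hA_nonneg]
  · have he : energy n L x (t • u) = t * p - f t := by
      simp [energy, hp, hfdef]
    rw [he]
    linarith [tangent 1]

end IsTonelliLagrangian

/-- A priori compactness: given `T, M > 0` there is `R > 0` such that any
extremal curve on `[0, T]` with action `< M` is `R`-Lipschitz (its velocity is bounded by
`R`); moreover the same `R` works for any other Tonelli Lagrangian coinciding with `L` on
`ℝⁿ × B(0, R)`. -/
theorem a_priori_compactness (n k : ℕ) (hn : 1 ≤ n) (hk : 2 ≤ k)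
    (L : E n × E n → ℝ) (hL : IsTonelliLagrangian n (k : ℕ∞) L) :
    ∀ T M : ℝ, 0 < T → 0 < M → ∃ R : ℝ, 0 < R ∧
      (∀ δ : ℝ → E n, IsExtremal n L δ →
        (∫ s in (0:ℝ)..T, L (δ s, deriv δ s)) < M →
        ∀ s ∈ Set.Icc (0:ℝ) T, ‖deriv δ s‖ ≤ R) ∧
      (∀ (k' : ℕ), 2 ≤ k' → ∀ L' : E n × E n → ℝ, IsTonelliLagrangian n (k' : ℕ∞) L' →
        (∀ x v : E n, ‖v‖ < R → L' (x, v) = L (x, v)) →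
        ∀ δ : ℝ → E n, IsExtremal n L' δ →
        (∫ s in (0:ℝ)..T, L' (δ s, deriv δ s)) < M →
        ∀ s ∈ Set.Icc (0:ℝ) T, ‖deriv δ s‖ ≤ R) := by
  intro T M hT hM
  have two_le : ∀ {j : ℕ}, 2 ≤ j → (2 : ℕ∞) ≤ j := fun h => by exact_mod_cast h
  have hsm : ContDiff ℝ 1 L := hL.smooth.of_le (by exact_mod_cast (by omega : 1 ≤ k))
  obtain ⟨A, hA⟩ := exists_abs_le_of_periodic (f := fun x v => L (x, v)) hsm.continuous
    hL.periodic 1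
  obtain ⟨r₁, hr₁⟩ := hL.superlinear (A + M / T)
  set r := max 1 r₁
  obtain ⟨H, hH⟩ := exists_abs_le_of_periodic (continuous_energy hsm)
    (fun x v m => energy_congr (Filter.Eventually.of_forall fun w => hL.periodic x w m)) r
  obtain ⟨q₁, hq₁⟩ := hL.superlinear (H + 2 * A + 1)
  set q := max r q₁
  have h1r : 1 ≤ r := le_max_left _ _
  have hrq : r ≤ q := le_max_left _ _
  have key : ∀ (k' : ℕ), 2 ≤ k' → ∀ L' : E n × E n → ℝ,
      IsTonelliLagrangian n (k' : ℕ∞) L' →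
      (∀ x v : E n, ‖v‖ < q + 1 → L' (x, v) = L (x, v)) →
      ∀ δ : ℝ → E n, IsExtremal n L' δ →
      (∫ s in (0:ℝ)..T, L' (δ s, deriv δ s)) < M →
      ∀ s ∈ Set.Icc (0:ℝ) T, ‖deriv δ s‖ ≤ q + 1 := by
    intro k' hk' L' hL' heq δ hδ hact s _
    have hk2 := two_le hk'
    have hA' : ∀ x v : E n, ‖v‖ ≤ 1 → |L' (x, v)| ≤ A := fun x v hv => by
      rw [heq x v (by linarith)]; exact hA x v hv
    obtain ⟨s₀, hs₀⟩ : ∃ s₀, ‖deriv δ s₀‖ < r := by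
      by_contra! hcon
      refine hact.not_ge ?_
      have hle : ∀ s, M / T ≤ L' (δ s, deriv δ s) := fun s => by
        have h := (hL'.lower_bounds hk2 h1r hA' (C := A + M / T) (fun x v hv => by
          rw [heq x v (by linarith), ← hv]
          exact hr₁ x v (hv ▸ le_max_right _ _)) (δ s) (hcon s)).1
        rw [add_sub_cancel_left] at h
        exact (le_mul_of_one_le_right (by positivity) (h1r.trans (hcon s))).trans h
      have hcont : Continuous fun s => L' (δ s, deriv δ s) :=
        hL'.smooth.continuous.comp
          (hδ.1.continuous.prodMk (hδ.1.continuous_deriv (by norm_num)))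
      have := intervalIntegral.integral_mono_on hT.le
        (intervalIntegrable_const (μ := volume) (c := M / T)) (hcont.intervalIntegrable 0 T)
        (fun s _ => hle s)
      simpa [mul_div_cancel_left₀ _ hT.ne'] using this
    by_contra! hcon
    have hlow := (hL'.lower_bounds hk2 (h1r.trans hrq) hA' (C := H + 2 * A + 1)
      (fun x v hv => by
        rw [heq x v (by linarith), ← hv]
        exact hq₁ x v (hv ▸ le_max_right _ _)) (δ s) (by linarith : q ≤ ‖deriv δ s‖)).2
    have hen : energy n L' (δ s₀) (deriv δ s₀) = energy n L (δ s₀) (deriv δ s₀) := by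
      refine energy_congr ?_
      filter_upwards [(isOpen_lt continuous_norm continuous_const).mem_nhds
        (show ‖deriv δ s₀‖ < q + 1 by linarith)] with w hw using heq _ w hw
    have hup := (abs_le.1 (hH (δ s₀) _ hs₀.le)).2
    rw [hδ.energy_eq (hL'.differentiable hk2) s s₀, hen] at hlow
    linarith
  exact ⟨q + 1, by linarith, key k hk L hL fun _ _ _ => rfl, key⟩

end
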